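/- Uniqueness of the radial profile: Assume a², b², c² > 0 with b⁴ ≤ 3a²c², let k ∈ ℤ \ {0} and R ∈ (0,∞]. If (u₁,v₁) and (u₂,v₂) are two profile solutions on (0,R) such that u₁ > 0, v₁ < 0, u₂ > 0 and v₂ < 0 on (0,R), then u₁ = u₂ and v₁ = v₂ on (0,R). -/

import Mathlib

open Real MeasureTheory Filter Set Topology
open scoped ENNReal

noncomputable section

/-- `s₊ = (b² + √(b⁴ + 24 a² c²)) / (4c²)`, where `a2 = a²`, `b2 = b²`, `c2 = c²`. -/
def sPlus (a2 b2 c2 : ℝ) : ℝ := (b2 + Real.sqrt (b2 ^ 2 + 24 * a2 * c2)) / (4 * c2)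

/-- `h(p,q) = p(−a² + (2b²/√6)q + c²(p² + q²))`. -/
def hfun (a2 b2 c2 p q : ℝ) : ℝ :=
  p * (-a2 + 2 * b2 / Real.sqrt 6 * q + c2 * (p ^ 2 + q ^ 2))

/-- `g(p,q) = q(−a² − (b²/√6)q + c²(p² + q²)) + (b²/√6)p²`. -/
def gfun (a2 b2 c2 p q : ℝ) : ℝ :=
  q * (-a2 - b2 / Real.sqrt 6 * q + c2 * (p ^ 2 + q ^ 2)) + b2 / Real.sqrt 6 * p ^ 2

/-- The interval `(0, R)` for `R ∈ (0,∞]`, as a subset of `ℝ`. -/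
def Iset (R : ℝ≥0∞) : Set ℝ := {r : ℝ | 0 < r ∧ ENNReal.ofReal r < R}

/-- The filter of left-approach to the right endpoint `R`; `atTop` when `R = ∞`. -/
def endFilter (R : ℝ≥0∞) : Filter ℝ :=
  if R = ⊤ then Filter.atTop else nhdsWithin R.toReal (Set.Iio R.toReal)

/-- A profile solution on `(0,R)`: a C² pair `(u,v)` solving the radial ODE system with the
natural boundary conditions at `0` and at `R`. -/
structure ProfileSolution (a2 b2 c2 : ℝ) (k : ℤ) (R : ℝ≥0∞) (u v : ℝ → ℝ) : Prop where
  smooth_u : ContDiffOn ℝ 2 u (Iset R)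
  smooth_v : ContDiffOn ℝ 2 v (Iset R)
  ode_u : ∀ r ∈ Iset R,
    deriv (deriv u) r + deriv u r / r - (k : ℝ) ^ 2 / r ^ 2 * u r
      = hfun a2 b2 c2 (u r) (v r)
  ode_v : ∀ r ∈ Iset R,
    deriv (deriv v) r + deriv v r / r = gfun a2 b2 c2 (u r) (v r)
  bc0_u : Filter.Tendsto u (nhdsWithin 0 (Set.Ioi 0)) (nhds 0)
  bc0_v : Filter.Tendsto (deriv v) (nhdsWithin 0 (Set.Ioi 0)) (nhds 0)
  bcR_u : Filter.Tendsto u (endFilter R) (nhds (sPlus a2 b2 c2 / Real.sqrt 2))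
  bcR_v : Filter.Tendsto v (endFilter R) (nhds (-(sPlus a2 b2 c2 / Real.sqrt 6)))

lemma isOpen_Iset (R : ℝ≥0∞) : IsOpen (Iset R) :=
  (isOpen_lt continuous_const continuous_id).inter
    (isOpen_lt ENNReal.continuous_ofReal continuous_const)

lemma convex_Iset (R : ℝ≥0∞) : Convex ℝ (Iset R) := by
  refine Set.OrdConnected.convex ⟨?_⟩
  rintro x ⟨hx, -⟩ y ⟨-, hy⟩ z ⟨hxz, hzy⟩
  exact ⟨hx.trans_le hxz, (ENNReal.ofReal_le_ofReal hzy).trans_lt hy⟩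

lemma eventually_mem_Iset_zero {R : ℝ≥0∞} (hR : 0 < R) : ∀ᶠ r in 𝓝[>] (0 : ℝ), r ∈ Iset R := by
  have h : ∀ᶠ r in 𝓝 (0 : ℝ), ENNReal.ofReal r < R :=
    (isOpen_lt ENNReal.continuous_ofReal continuous_const).mem_nhds (by simpa using hR)
  filter_upwards [nhdsWithin_le_nhds h, self_mem_nhdsWithin] with r h1 h2 using ⟨h2, h1⟩

instance endFilter_neBot (R : ℝ≥0∞) : (endFilter R).NeBot := by
  unfold endFilter
  split_ifs <;> infer_instance

lemma eventually_mem_Iset_end {R : ℝ≥0∞} {r₀ : ℝ} (h : r₀ ∈ Iset R) :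
    ∀ᶠ r in endFilter R, r ∈ Iset R ∧ r₀ < r := by
  unfold endFilter
  split_ifs with hR
  · filter_upwards [eventually_gt_atTop r₀] with r hr
    exact ⟨⟨h.1.trans hr, by simp [hR]⟩, hr⟩
  · have h2 : r₀ < R.toReal := (ENNReal.ofReal_lt_iff_lt_toReal h.1.le hR).1 h.2
    filter_upwards [Ioo_mem_nhdsLT h2] with r hr
    exact ⟨⟨h.1.trans hr.1, (ENNReal.ofReal_lt_iff_lt_toReal (h.1.trans hr.1).le hR).2 hr.2⟩, hr.1⟩

lemma hasDerivAt_of_contDiffOn_two {s : Set ℝ} (hs : IsOpen s) {f : ℝ → ℝ}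
    (hf : ContDiffOn ℝ 2 f s) {r : ℝ} (hr : r ∈ s) :
    HasDerivAt f (deriv f r) r ∧ HasDerivAt (deriv f) (deriv (deriv f) r) r := by
  have h1 : ContDiffOn ℝ 1 (deriv f) s := hf.deriv_of_isOpen hs (by norm_num)
  exact ⟨((hf.differentiableOn (by norm_num)).differentiableAt (hs.mem_nhds hr)).hasDerivAt,
    ((h1.differentiableOn (by norm_num)).differentiableAt (hs.mem_nhds hr)).hasDerivAt⟩

lemma monotoneOn_of_hasDerivAt_nonneg {s : Set ℝ} (hs : Convex ℝ s) {f f' : ℝ → ℝ}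
    (hf : ∀ r ∈ s, HasDerivAt f (f' r) r) (h : ∀ r ∈ s, 0 ≤ f' r) : MonotoneOn f s := by
  refine monotoneOn_of_deriv_nonneg hs (fun r hr => (hf r hr).continuousAt.continuousWithinAt)
    (fun r hr => (hf r (interior_subset hr)).differentiableAt.differentiableWithinAt)
    (fun r hr => ?_)
  rw [(hf r (interior_subset hr)).deriv]
  exact h r (interior_subset hr)

lemma hasDerivAt_max_zero_sq (x : ℝ) :
    HasDerivAt (fun y : ℝ => max y 0 ^ 2) (2 * max x 0) x := by
  rcases lt_trichotomy x 0 with hx | rfl | hx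
  · rw [max_eq_right hx.le, mul_zero]
    refine (hasDerivAt_const x (0 : ℝ)).congr_of_eventuallyEq ?_
    filter_upwards [Iio_mem_nhds hx] with y hy
    simp [max_eq_right (le_of_lt (Set.mem_Iio.1 hy))]
  · rw [max_self, mul_zero, hasDerivAt_iff_isLittleO_nhds_zero]
    have h : (fun h : ℝ => h ^ 2) =o[𝓝 0] fun h : ℝ => h := by
      simpa using Asymptotics.isLittleO_pow_id (𝕜 := ℝ) (n := 2) (by norm_num)
    refine Asymptotics.IsBigO.trans_isLittleO (Asymptotics.IsBigO.of_bound 1 ?_) h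
    filter_upwards with y
    rcases le_total y 0 with hy | hy
    · simp [max_eq_right hy]; positivity
    · simp [max_eq_left hy]
  · rw [max_eq_left hx.le]
    have := (hasDerivAt_pow 2 x)
    simp only [Nat.cast_ofNat, Nat.add_one_sub_one, pow_one] at this
    refine this.congr_of_eventuallyEq ?_
    filter_upwards [Ioi_mem_nhds hx] with y hy
    simp [max_eq_left (le_of_lt (Set.mem_Ioi.1 hy))]

/-- A maximum principle for radial functions that are strictly subharmonic above the level
`-m`. -/
lemma le_neg_of_radial_subharmonic {R : ℝ≥0∞} (hR : 0 < R) {v : ℝ → ℝ} {m ℓ : ℝ}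
    (hsm : ContDiffOn ℝ 2 v (Iset R)) (hneg : ∀ r ∈ Iset R, v r < 0)
    (hode : ∀ r ∈ Iset R, -m < v r → 0 ≤ deriv (deriv v) r + deriv v r / r)
    (h0 : Tendsto (deriv v) (𝓝[>] 0) (𝓝 0)) (hv : Tendsto v (endFilter R) (𝓝 ℓ))
    (hℓ : ℓ ≤ -m) : ∀ r ∈ Iset R, v r ≤ -m := by
  have hI := isOpen_Iset R
  have hder : ∀ r ∈ Iset R, HasDerivAt v (deriv v r) r ∧
      HasDerivAt (deriv v) (deriv (deriv v) r) r :=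
    fun r hr => hasDerivAt_of_contDiffOn_two hI hsm hr
  have hsq : ∀ r ∈ Iset R, HasDerivAt (fun r => max (v r + m) 0 ^ 2)
      (2 * max (v r + m) 0 * deriv v r) r := fun r hr =>
    HasDerivAt.comp (h₂ := fun y : ℝ => max y 0 ^ 2) r
      (hasDerivAt_max_zero_sq (v r + m)) ((hder r hr).1.add_const m)
  have hmono : MonotoneOn (fun r => r * deriv v r * max (v r + m) 0 ^ 2) (Iset R) := by
    refine monotoneOn_of_hasDerivAt_nonneg (convex_Iset R)
      (fun r hr => (((hasDerivAt_id r).mul (hder r hr).2).mul (hsq r hr))) (fun r hr => ?_)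
    have hr0 : 0 < r := hr.1
    simp only [Pi.mul_apply, id, one_mul]
    rcases le_or_gt (v r + m) 0 with h | h
    · simp [max_eq_right h]
    · have h1 := hode r hr (by linarith)
      have h2 : deriv v r + r * deriv (deriv v) r
          = r * (deriv (deriv v) r + deriv v r / r) := by field_simp; ring
      rw [h2, max_eq_left h.le]
      have : 0 ≤ r * (deriv (deriv v) r + deriv v r / r) * (v r + m) ^ 2 := by positivity
      have : 0 ≤ r * (v r + m) * deriv v r ^ 2 := by positivity
      linarith
  have hlim : Tendsto (fun r => r * deriv v r * max (v r + m) 0 ^ 2) (𝓝[>] 0) (𝓝 0) := by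
    have h1 : Tendsto (fun r : ℝ => |r * deriv v r| * max m 0 ^ 2) (𝓝[>] 0) (𝓝 0) := by
      have h2 : Tendsto (fun r : ℝ => r) (𝓝[>] 0) (𝓝 0) := nhdsWithin_le_nhds
      simpa using ((h2.mul h0).abs).mul_const (max m 0 ^ 2)
    refine squeeze_zero_norm' ?_ h1
    filter_upwards [eventually_mem_Iset_zero hR] with r hr
    rw [norm_mul, Real.norm_eq_abs, Real.norm_eq_abs, abs_of_nonneg (sq_nonneg (max (v r + m) 0))]
    have : max (v r + m) 0 ≤ max m 0 := max_le_max_right 0 (by linarith [hneg r hr])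
    gcongr
  have hnonneg : ∀ r ∈ Iset R, 0 ≤ r * deriv v r * max (v r + m) 0 ^ 2 := by
    intro r hr
    refine le_of_tendsto hlim ?_
    filter_upwards [eventually_mem_Iset_zero hR, Ioo_mem_nhdsGT hr.1] with x hx hxr
    exact hmono hx hr hxr.2.le
  have hmono2 : MonotoneOn (fun r => (max (v r + m) 0 ^ 2) ^ 2) (Iset R) := by
    refine monotoneOn_of_hasDerivAt_nonneg (convex_Iset R) (fun r hr => (hsq r hr).pow 2)
      (fun r hr => ?_)
    have hr0 : 0 < r := hr.1
    have h1 : 0 ≤ deriv v r * max (v r + m) 0 ^ 2 := by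
      have := hnonneg r hr
      rw [mul_assoc] at this
      exact nonneg_of_mul_nonneg_right this hr0
    have h2 : 0 ≤ max (v r + m) 0 := le_max_right _ _
    have := mul_nonneg h2 h1
    simp only [Nat.cast_ofNat, Nat.add_one_sub_one, pow_one]
    nlinarith
  intro r hr
  have hlim2 : Tendsto (fun r => (max (v r + m) 0 ^ 2) ^ 2) (endFilter R)
      (𝓝 ((max (ℓ + m) 0 ^ 2) ^ 2)) :=
    ((((hv.add_const m).max tendsto_const_nhds)).pow 2).pow 2
  have h3 : (max (v r + m) 0 ^ 2) ^ 2 ≤ (max (ℓ + m) 0 ^ 2) ^ 2 := by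
    refine ge_of_tendsto hlim2 ?_
    filter_upwards [eventually_mem_Iset_end hr] with x hx
    exact hmono2 hr hx.1 hx.2.le
  rw [max_eq_right (show ℓ + m ≤ 0 by linarith)] at h3
  by_contra! hcon
  have : 0 < v r + m := by linarith
  rw [max_eq_left this.le] at h3
  have : 0 < ((v r + m) ^ 2) ^ 2 := by positivity
  norm_num at h3
  linarith

/-- Picone's identity for two solutions of radial equations `u'' + u' / r = A`. -/
lemma hasDerivAt_picone {u₁ u₂ : ℝ → ℝ} {r p₁ p₂ A₁ A₂ : ℝ} (hr : r ≠ 0)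
    (h₁ : HasDerivAt u₁ (deriv u₁ r) r ∧ HasDerivAt (deriv u₁) p₁ r)
    (h₂ : HasDerivAt u₂ (deriv u₂ r) r ∧ HasDerivAt (deriv u₂) p₂ r)
    (hu₁ : u₁ r ≠ 0) (hu₂ : u₂ r ≠ 0)
    (hA₁ : p₁ + deriv u₁ r / r = A₁) (hA₂ : p₂ + deriv u₂ r / r = A₂) :
    HasDerivAt (fun x => x * (deriv u₁ x / u₁ x - deriv u₂ x / u₂ x) * (u₁ x ^ 2 - u₂ x ^ 2))
      (r * ((A₁ / u₁ r - A₂ / u₂ r) * (u₁ r ^ 2 - u₂ r ^ 2)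
        + (deriv u₁ r / u₁ r - deriv u₂ r / u₂ r) ^ 2 * (u₁ r ^ 2 + u₂ r ^ 2))) r := by
  have h := ((hasDerivAt_id r).mul ((h₁.2.div h₁.1 hu₁).sub (h₂.2.div h₂.1 hu₂))).mul
    ((h₁.1.pow 2).sub (h₂.1.pow 2))
  refine h.congr_deriv ?_
  simp only [Pi.mul_apply, Pi.sub_apply, Pi.div_apply, Pi.pow_apply, id]
  subst hA₁ hA₂
  field_simp
  ring

lemma nonneg_of_sq_le_mul_deriv {B B' : ℝ → ℝ} {C ρ : ℝ} (hC : 0 < C)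
    (hB : ∀ r ∈ Ioo 0 ρ, HasDerivAt B (B' r) r) (hB' : ∀ r ∈ Ioo 0 ρ, 0 ≤ B' r)
    (h : ∀ r ∈ Ioo 0 ρ, B r ^ 2 ≤ C * r * B' r) : ∀ r ∈ Ioo 0 ρ, 0 ≤ B r := by
  intro r₀ hr₀
  by_contra! hneg
  have hmono := monotoneOn_of_hasDerivAt_nonneg (convex_Ioo 0 ρ) hB hB'
  have hlt : ∀ r ∈ Ioc 0 r₀, B r < 0 := fun r hr =>
    (hmono ⟨hr.1, hr.2.trans_lt hr₀.2⟩ hr₀ hr.2).trans_lt hneg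
  have hm2 : MonotoneOn (fun r => -(B r)⁻¹ - C⁻¹ * Real.log r) (Ioc 0 r₀) := by
    refine monotoneOn_of_hasDerivAt_nonneg (convex_Ioc 0 r₀) (fun r hr =>
      ((hB r ⟨hr.1, hr.2.trans_lt hr₀.2⟩).inv (hlt r hr).ne).neg.sub
        ((Real.hasDerivAt_log hr.1.ne').const_mul C⁻¹)) (fun r hr => ?_)
    have h1 := h r ⟨hr.1, hr.2.trans_lt hr₀.2⟩
    have h2 : 0 < B r ^ 2 := sq_pos_of_neg (hlt r hr)
    have h3 : 0 < r := hr.1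
    rw [neg_div, neg_neg, sub_nonneg, ← mul_inv, inv_eq_one_div, div_le_div_iff₀ (by positivity) h2]
    linarith
  have hlog : Tendsto (fun r => C⁻¹ * (Real.log r₀ - Real.log r)) (𝓝[>] 0) atTop := by
    refine Tendsto.const_mul_atTop (by positivity) ?_
    exact tendsto_atTop_add_const_left _ _ (tendsto_neg_atBot_atTop.comp Real.tendsto_log_nhdsGT_zero)
  obtain ⟨r, hr1, hr2⟩ := ((hlog.eventually_gt_atTop (-(B r₀)⁻¹)).and
    (Ioo_mem_nhdsGT hr₀.1)).exists
  have h1 := hm2 ⟨hr2.1, hr2.2.le⟩ ⟨hr₀.1, le_rfl⟩ hr2.2.le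
  have h2 := inv_lt_zero.2 (hlt r ⟨hr2.1, hr2.2.le⟩)
  simp only at h1
  linarith

lemma nonpos_of_sq_le_mul_deriv {B B' : ℝ → ℝ} {C ρ : ℝ} (hC : 0 < C) (hρ : 0 ≤ ρ)
    (hB : ∀ r ∈ Ioi ρ, HasDerivAt B (B' r) r) (hB' : ∀ r ∈ Ioi ρ, 0 ≤ B' r)
    (h : ∀ r ∈ Ioi ρ, B r ^ 2 ≤ C * r * B' r) : ∀ r ∈ Ioi ρ, B r ≤ 0 := by
  intro r₀ hr₀
  by_contra! hpos
  have hmono := monotoneOn_of_hasDerivAt_nonneg (convex_Ioi ρ) hB hB'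
  have hsub : ∀ r ∈ Ici r₀, r ∈ Ioi ρ := fun r hr =>
    lt_of_lt_of_le (Set.mem_Ioi.1 hr₀) (Set.mem_Ici.1 hr)
  have hgt : ∀ r ∈ Ici r₀, 0 < B r := fun r hr => hpos.trans_le (hmono hr₀ (hsub r hr) hr)
  have hr0 : ∀ r ∈ Ici r₀, 0 < r := fun r hr => hρ.trans_lt (hsub r hr)
  have hm2 : MonotoneOn (fun r => -(B r)⁻¹ - C⁻¹ * Real.log r) (Ici r₀) := by
    refine monotoneOn_of_hasDerivAt_nonneg (convex_Ici r₀) (fun r hr =>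
      ((hB r (hsub r hr)).inv (hgt r hr).ne').neg.sub
        ((Real.hasDerivAt_log (hr0 r hr).ne').const_mul C⁻¹)) (fun r hr => ?_)
    have h1 := h r (hsub r hr)
    have h2 : 0 < B r ^ 2 := by have := hgt r hr; positivity
    have h3 : 0 < r := hr0 r hr
    rw [neg_div, neg_neg, sub_nonneg, ← mul_inv, inv_eq_one_div, div_le_div_iff₀ (by positivity) h2]
    linarith
  have hlog : Tendsto (fun r => C⁻¹ * (Real.log r - Real.log r₀)) atTop atTop := by
    refine Tendsto.const_mul_atTop (by positivity) ?_
    exact tendsto_atTop_add_const_right _ _ Real.tendsto_log_atTop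
  obtain ⟨r, hr1, hr2⟩ := ((hlog.eventually_gt_atTop ((B r₀)⁻¹)).and
    (eventually_ge_atTop r₀)).exists
  have h1 := hm2 (Set.mem_Ici.2 le_rfl) (Set.mem_Ici.2 hr2) hr2
  have h2 := inv_pos.2 (hgt r hr2)
  simp only at h1
  linarith

lemma eventually_abs_le_of_tendsto_deriv {f f' : ℝ → ℝ} {ρ R ℓ : ℝ} (hρ : ρ < R)
    (hf : ∀ r ∈ Ioo ρ R, HasDerivAt f (f' r) r) (hf' : Tendsto f' (𝓝[<] R) (𝓝 ℓ)) :
    ∃ C, ∀ᶠ r in 𝓝[<] R, |f r| ≤ C := by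
  have h1 : ∀ᶠ r in 𝓝[<] R, |f' r| < |ℓ| + 1 := hf'.abs.eventually_lt_const (by linarith)
  obtain ⟨x, hx, hsub⟩ := (mem_nhdsLT_iff_exists_Ioo_subset' hρ).1
    (h1.and (Ioo_mem_nhdsLT hρ))
  obtain ⟨y, hy⟩ := nonempty_Ioo.2 (Set.mem_Iio.1 hx)
  refine ⟨|f y| + (|ℓ| + 1) * (R - x), ?_⟩
  filter_upwards [Ioo_mem_nhdsLT (Set.mem_Iio.1 hx)] with r hr
  have h2 := (convex_Ioo x R).norm_image_sub_le_of_norm_hasDerivWithin_le (f := f) (f' := f')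
    (C := |ℓ| + 1) (fun z hz => (hf z (hsub hz).2).hasDerivWithinAt)
    (fun z hz => (hsub hz).1.le) hy hr
  rw [Real.norm_eq_abs, Real.norm_eq_abs] at h2
  have h3 : |r - y| ≤ R - x := by
    rw [abs_le]; constructor <;> linarith [hr.1, hr.2, hy.1, hy.2]
  have h4 : (|ℓ| + 1) * |r - y| ≤ (|ℓ| + 1) * (R - x) := by gcongr
  have h5 := abs_sub_abs_le_abs_sub (f r) (f y)
  linarith

/-- Monotonicity of the gradient of the potential in the variables `(p², q²)`, in the region
`q ≤ -β / c`. -/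
lemma potential_monotone {a β c p₁ p₂ q₁ q₂ : ℝ} (hβ : 0 < β) (hc : 0 < c)
    (h₁ : β ≤ c * q₁) (h₂ : β ≤ c * q₂) :
    0 ≤ ((-a - 2 * β * q₁ + c * (p₁ ^ 2 + q₁ ^ 2)) - (-a - 2 * β * q₂ + c * (p₂ ^ 2 + q₂ ^ 2)))
        * (p₁ ^ 2 - p₂ ^ 2)
      + ((-a + β * q₁ + c * (p₁ ^ 2 + q₁ ^ 2) - β * p₁ ^ 2 / q₁)
        - (-a + β * q₂ + c * (p₂ ^ 2 + q₂ ^ 2) - β * p₂ ^ 2 / q₂)) * (q₁ ^ 2 - q₂ ^ 2) := by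
  have hq₁ : 0 < q₁ := pos_of_mul_pos_right (hβ.trans_le h₁) hc.le
  have hq₂ : 0 < q₂ := pos_of_mul_pos_right (hβ.trans_le h₂) hc.le
  set σ := q₁ + q₂ with hσ
  set τ := 2 + σ ^ 2 / (2 * (q₁ * q₂)) with hτ
  set X := p₁ ^ 2 - p₂ ^ 2 + (q₁ - q₂) * σ with hX
  set d := q₁ - q₂ with hd
  have hσ0 : 0 < σ := by positivity
  have hτ0 : 0 < τ := by positivity
  have hτσ : β * τ ≤ 2 * β + c * σ := by
    have : β * (σ ^ 2 / (2 * (q₁ * q₂))) ≤ c * σ := by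
      rw [← mul_div_assoc, div_le_iff₀ (by positivity)]
      have : β * σ ≤ 2 * c * (q₁ * q₂) := by
        nlinarith [mul_le_mul_of_nonneg_right h₁ hq₂.le, mul_le_mul_of_nonneg_right h₂ hq₁.le]
      nlinarith
    rw [hτ]; linarith
  have hσβ : 2 * β ≤ c * σ := by rw [hσ]; linarith
  have hdisc : β * τ ^ 2 ≤ 4 * c * σ * (τ + 1) := by
    have : 0 < c * σ := by positivity
    nlinarith
  have key : ((-a - 2 * β * q₁ + c * (p₁ ^ 2 + q₁ ^ 2))
        - (-a - 2 * β * q₂ + c * (p₂ ^ 2 + q₂ ^ 2))) * (p₁ ^ 2 - p₂ ^ 2)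
      + ((-a + β * q₁ + c * (p₁ ^ 2 + q₁ ^ 2) - β * p₁ ^ 2 / q₁)
        - (-a + β * q₂ + c * (p₂ ^ 2 + q₂ ^ 2) - β * p₂ ^ 2 / q₂)) * (q₁ ^ 2 - q₂ ^ 2)
      = c * X ^ 2 - β * d * X * τ + β * σ * d ^ 2 * (τ + 1)
        + β * σ * ((p₁ ^ 2 + p₂ ^ 2) / 2) * d ^ 2 / (q₁ * q₂) := by
    rw [hτ, hX, hd, hσ]
    field_simp
    ring
  rw [key]
  have h1 : 0 ≤ c * X ^ 2 - β * d * X * τ + β * σ * d ^ 2 * (τ + 1) := by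
    have h2 : 0 ≤ 4 * c * (c * X ^ 2 - β * d * X * τ + β * σ * d ^ 2 * (τ + 1)) := by
      have h3 : 0 ≤ β * d ^ 2 * (4 * c * σ * (τ + 1) - β * τ ^ 2) := by
        have := sub_nonneg.2 hdisc
        positivity
      nlinarith [sq_nonneg (2 * c * X - β * d * τ)]
    exact nonneg_of_mul_nonneg_right h2 (by positivity)
  positivity

lemma div_le_sPlus {a2 b2 c2 : ℝ} (hc : 0 < c2) (hle : b2 ^ 2 ≤ 3 * a2 * c2) :
    b2 / c2 ≤ sPlus a2 b2 c2 := by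
  unfold sPlus
  have h : 3 * b2 ≤ Real.sqrt (b2 ^ 2 + 24 * a2 * c2) := Real.le_sqrt_of_sq_le (by nlinarith)
  rw [div_le_div_iff₀ hc (by positivity)]
  nlinarith

lemma gfun_nonneg {a2 b2 c2 p q : ℝ} (hb : 0 < b2) (hc : 0 < c2)
    (hle : b2 ^ 2 ≤ 3 * a2 * c2) (hq : q < 0) (hq' : -(b2 / Real.sqrt 6 / c2) < q) :
    0 ≤ gfun a2 b2 c2 p q := by
  unfold gfun
  set β := b2 / Real.sqrt 6 with hβ
  have hβ0 : 0 < β := by positivity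
  have hβ2 : 2 * β ^ 2 ≤ a2 * c2 := by
    rw [hβ, div_pow, Real.sq_sqrt (by norm_num)]; linarith
  have h1 : 0 < c2 * q + β := by
    have : -β < q * c2 := by rwa [← neg_div, div_lt_iff₀ hc] at hq'
    linarith
  have h2 : -a2 - β * q + c2 * q ^ 2 ≤ 0 := by
    have h3 : c2 * (-a2 - β * q + c2 * q ^ 2) ≤ 0 := by
      nlinarith [mul_pos h1 (neg_pos.2 hq), mul_pos h1 hβ0]
    exact nonpos_of_mul_nonpos_right h3 hc
  have h4 := mul_nonneg_of_nonpos_of_nonpos hq.le h2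
  nlinarith [mul_nonneg h1.le (sq_nonneg p)]

lemma ProfileSolution.v_le {a2 b2 c2 : ℝ} (hb : 0 < b2) (hc : 0 < c2)
    (hle : b2 ^ 2 ≤ 3 * a2 * c2) {k : ℤ} {R : ℝ≥0∞} (hR : 0 < R) {u v : ℝ → ℝ}
    (h : ProfileSolution a2 b2 c2 k R u v) (hv : ∀ r ∈ Iset R, v r < 0) :
    ∀ r ∈ Iset R, v r ≤ -(b2 / Real.sqrt 6 / c2) := by
  refine le_neg_of_radial_subharmonic hR h.smooth_v hv (fun r hr hm => ?_) h.bc0_v h.bcR_v ?_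
  · rw [h.ode_v r hr]
    exact gfun_nonneg hb hc hle (hv r hr) hm
  · rw [neg_le_neg_iff, div_right_comm]
    have := div_le_sPlus hc hle
    gcongr

lemma ProfileSolution.eventually_bounded_zero {a2 b2 c2 : ℝ} {k : ℤ} {R : ℝ≥0∞} (hR : 0 < R)
    {u v : ℝ → ℝ} (h : ProfileSolution a2 b2 c2 k R u v) (hv : ∀ r ∈ Iset R, v r < 0) :
    ∃ C, ∀ᶠ r in 𝓝[>] (0 : ℝ), u r ^ 2 + v r ^ 2 ≤ C := by
  have h1 : ∀ᶠ r in 𝓝[>] (0 : ℝ), u r ^ 2 < 1 := by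
    have := h.bc0_u.pow 2
    exact this.eventually_lt_const (by norm_num)
  have h2 : ∀ᶠ r in 𝓝[>] (0 : ℝ), deriv v r < 1 := h.bc0_v.eventually_lt_const (by norm_num)
  obtain ⟨ρ, hρ, hsub⟩ := mem_nhdsGT_iff_exists_Ioo_subset.1
    (h2.and (eventually_mem_Iset_zero hR))
  obtain ⟨y, hy⟩ := nonempty_Ioo.2 (Set.mem_Ioi.1 hρ)
  have hmono : MonotoneOn (fun r => r - v r) (Ioo 0 ρ) := by
    refine monotoneOn_of_hasDerivAt_nonneg (convex_Ioo 0 ρ) (fun r hr => (hasDerivAt_id r).sub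
      (hasDerivAt_of_contDiffOn_two (isOpen_Iset R) h.smooth_v (hsub hr).2).1) (fun r hr => ?_)
    linarith [(hsub hr).1]
  refine ⟨1 + (y - v y) ^ 2, ?_⟩
  filter_upwards [h1, Ioo_mem_nhdsGT hy.1] with r hr1 hr2
  have hr3 : r ∈ Ioo 0 ρ := ⟨hr2.1, hr2.2.trans hy.2⟩
  have h3 := hmono hr3 hy hr2.2.le
  have h4 := hv r (hsub hr3).2
  have h5 : v r ^ 2 ≤ (y - v y) ^ 2 := by
    simp only at h3
    nlinarith [hr2.1]
  linarith

lemma ProfileSolution.eventually_bounded_end {a2 b2 c2 : ℝ} {k : ℤ} {R : ℝ≥0∞}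
    {u v : ℝ → ℝ} (h : ProfileSolution a2 b2 c2 k R u v) :
    ∃ C, ∀ᶠ r in endFilter R, u r ^ 2 + v r ^ 2 ≤ C := by
  have h1 := (h.bcR_u.pow 2).add (h.bcR_v.pow 2)
  exact ⟨_, (h1.eventually_lt_const (lt_add_one _)).mono fun r hr => hr.le⟩

lemma ProfileSolution.eventually_deriv_bounded {a2 b2 c2 : ℝ} {k : ℤ} {R : ℝ≥0∞} (hR : 0 < R)
    (hR' : R ≠ ⊤) {u v : ℝ → ℝ} (h : ProfileSolution a2 b2 c2 k R u v) :
    (∃ C, ∀ᶠ r in endFilter R, |r * deriv u r| ≤ C) ∧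
      ∃ C, ∀ᶠ r in endFilter R, |r * deriv v r| ≤ C := by
  have hpos : 0 < R.toReal := ENNReal.toReal_pos hR.ne' hR'
  have hu := h.bcR_u
  have hv := h.bcR_v
  have hmem : ∀ r ∈ Ioo 0 R.toReal, r ∈ Iset R := fun r hr =>
    ⟨hr.1, (ENNReal.ofReal_lt_iff_lt_toReal hr.1.le hR').2 hr.2⟩
  simp only [endFilter, if_neg hR'] at hu hv ⊢
  have hid : Tendsto (fun r : ℝ => r) (𝓝[<] R.toReal) (𝓝 R.toReal) := nhdsWithin_le_nhds
  have hsum : Tendsto (fun r => u r ^ 2 + v r ^ 2) _ _ := (hu.pow 2).add (hv.pow 2)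
  constructor
  · refine eventually_abs_le_of_tendsto_deriv hpos
      (f' := fun r => r * ((k : ℝ) ^ 2 / r ^ 2 * u r + hfun a2 b2 c2 (u r) (v r)))
      (fun r hr => ?_) (hid.mul (((tendsto_const_nhds.div (hid.pow 2) (by positivity)).mul hu).add
        (hu.mul ((tendsto_const_nhds.add (tendsto_const_nhds.mul hv)).add
          (tendsto_const_nhds.mul hsum)))))
    have hd := hasDerivAt_of_contDiffOn_two (isOpen_Iset R) h.smooth_u (hmem r hr)
    refine ((hasDerivAt_id r).mul hd.2).congr_deriv ?_
    rw [← h.ode_u r (hmem r hr)]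
    have := hr.1.ne'
    simp only [id]
    field_simp
    ring
  · refine eventually_abs_le_of_tendsto_deriv hpos
      (f' := fun r => r * gfun a2 b2 c2 (u r) (v r))
      (fun r hr => ?_) (hid.mul
        ((hv.mul ((tendsto_const_nhds.sub (tendsto_const_nhds.mul hv)).add
          (tendsto_const_nhds.mul hsum))).add (tendsto_const_nhds.mul (hu.pow 2))))
    have hd := hasDerivAt_of_contDiffOn_two (isOpen_Iset R) h.smooth_v (hmem r hr)
    refine ((hasDerivAt_id r).mul hd.2).congr_deriv ?_
    rw [← h.ode_v r (hmem r hr)]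
    have := hr.1.ne'
    simp only [id]
    field_simp
    ring

/-- The boundary term of Picone's identity vanishes where the two functions have a common
nonzero limit and `r u'` stays bounded. -/
lemma tendsto_picone_boundary {l : Filter ℝ} {u₁ u₂ : ℝ → ℝ} {ℓ : ℝ} (hℓ : ℓ ≠ 0)
    (h₁ : Tendsto u₁ l (𝓝 ℓ)) (h₂ : Tendsto u₂ l (𝓝 ℓ))
    (hd₁ : ∃ C, ∀ᶠ r in l, |r * deriv u₁ r| ≤ C) (hd₂ : ∃ C, ∀ᶠ r in l, |r * deriv u₂ r| ≤ C) :
    Tendsto (fun x => x * (deriv u₁ x / u₁ x - deriv u₂ x / u₂ x) * (u₁ x ^ 2 - u₂ x ^ 2)) l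
      (𝓝 0) := by
  obtain ⟨C₁, hC₁⟩ := hd₁
  obtain ⟨C₂, hC₂⟩ := hd₂
  have hdiff : Tendsto (fun x => u₁ x ^ 2 - u₂ x ^ 2) l (𝓝 0) := by
    simpa using (h₁.pow 2).sub (h₂.pow 2)
  have h3 : Tendsto (fun x => (x * deriv u₁ x) * ((u₁ x ^ 2 - u₂ x ^ 2) / u₁ x)) l (𝓝 0) := by
    refine bdd_le_mul_tendsto_zero' C₁ hC₁ ?_
    rw [← zero_div ℓ]
    exact hdiff.div h₁ hℓ
  have h4 : Tendsto (fun x => (x * deriv u₂ x) * ((u₁ x ^ 2 - u₂ x ^ 2) / u₂ x)) l (𝓝 0) := by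
    refine bdd_le_mul_tendsto_zero' C₂ hC₂ ?_
    rw [← zero_div ℓ]
    exact hdiff.div h₂ hℓ
  have h5 := h3.sub h4
  rw [sub_zero] at h5
  refine h5.congr fun x => ?_
  ring

lemma eqOn_of_logDeriv_eq {R : ℝ≥0∞} {u₁ u₂ : ℝ → ℝ} {ℓ : ℝ} (hℓ : ℓ ≠ 0)
    (h₁ : Tendsto u₁ (endFilter R) (𝓝 ℓ)) (h₂ : Tendsto u₂ (endFilter R) (𝓝 ℓ))
    (hd₁ : ∀ r ∈ Iset R, HasDerivAt u₁ (deriv u₁ r) r)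
    (hd₂ : ∀ r ∈ Iset R, HasDerivAt u₂ (deriv u₂ r) r)
    (hu₁ : ∀ r ∈ Iset R, u₁ r ≠ 0) (hu₂ : ∀ r ∈ Iset R, u₂ r ≠ 0)
    (h : ∀ r ∈ Iset R, deriv u₁ r / u₁ r = deriv u₂ r / u₂ r) :
    ∀ r ∈ Iset R, u₁ r = u₂ r := by
  intro r hr
  have hder : ∀ x ∈ Iset R, HasDerivAt (fun x => u₁ x / u₂ x) 0 x := by
    intro x hx
    refine ((hd₁ x hx).div (hd₂ x hx) (hu₂ x hx)).congr_deriv ?_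
    have h1 := h x hx
    rw [div_eq_div_iff (hu₁ x hx) (hu₂ x hx)] at h1
    rw [h1, mul_comm, sub_self, zero_div]
  have hconst : ∀ x ∈ Iset R, u₁ x / u₂ x = u₁ r / u₂ r := by
    intro x hx
    have := (convex_Iset R).norm_image_sub_le_of_norm_hasDerivWithin_le (C := 0)
      (fun z hz => (hder z hz).hasDerivWithinAt) (fun z _ => by simp) hr hx
    simpa [sub_eq_zero] using this
  have hlim : Tendsto (fun x => u₁ x / u₂ x) (endFilter R) (𝓝 1) := by
    rw [← div_self hℓ]
    exact h₁.div h₂ hℓ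
  have hlim2 : Tendsto (fun x => u₁ x / u₂ x) (endFilter R) (𝓝 (u₁ r / u₂ r)) :=
    tendsto_const_nhds.congr' ((eventually_mem_Iset_end hr).mono fun x hx => (hconst x hx.1).symm)
  exact (div_eq_one_iff_eq (hu₂ r hr)).1 (tendsto_nhds_unique hlim2 hlim)

lemma reaction_monotone {a2 b2 c2 K p₁ p₂ q₁ q₂ : ℝ} (hb : 0 < b2) (hc : 0 < c2)
    (hp₁ : 0 < p₁) (hp₂ : 0 < p₂) (h₁ : q₁ ≤ -(b2 / Real.sqrt 6 / c2))
    (h₂ : q₂ ≤ -(b2 / Real.sqrt 6 / c2)) :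
    0 ≤ ((K * p₁ + hfun a2 b2 c2 p₁ q₁) / p₁ - (K * p₂ + hfun a2 b2 c2 p₂ q₂) / p₂)
        * (p₁ ^ 2 - p₂ ^ 2)
      + (gfun a2 b2 c2 p₁ q₁ / q₁ - gfun a2 b2 c2 p₂ q₂ / q₂) * (q₁ ^ 2 - q₂ ^ 2) := by
  have hβ : 0 < b2 / Real.sqrt 6 := by positivity
  have hm : 0 < b2 / Real.sqrt 6 / c2 := by positivity
  have h₁' : b2 / Real.sqrt 6 ≤ c2 * -q₁ := by
    rw [← div_le_iff₀' hc]; linarith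
  have h₂' : b2 / Real.sqrt 6 ≤ c2 * -q₂ := by
    rw [← div_le_iff₀' hc]; linarith
  have hq₁ : q₁ ≠ 0 := by linarith
  have hq₂ : q₂ ≠ 0 := by linarith
  have key := potential_monotone (a := a2) (p₁ := p₁) (p₂ := p₂) hβ hc h₁' h₂'
  refine key.trans_eq ?_
  unfold hfun gfun
  field_simp
  ring

lemma add_sq_le_mul_add_of_sq_le {x y a b c d : ℝ} (ha : 0 ≤ a) (hb : 0 ≤ b) (hc : 0 ≤ c)
    (hd : 0 ≤ d) (hx : x ^ 2 ≤ a * c) (hy : y ^ 2 ≤ b * d) :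
    (x + y) ^ 2 ≤ (a + b) * (c + d) := by
  have h1 : (x * y) ^ 2 ≤ (a * d) * (b * c) := by
    calc (x * y) ^ 2 = x ^ 2 * y ^ 2 := by ring
      _ ≤ (a * c) * (b * d) := by gcongr
      _ = _ := by ring
  have h2 : 2 * (x * y) ≤ a * d + b * c := by
    refine le_of_abs_le (abs_le_of_sq_le_sq ?_ (by positivity))
    nlinarith [sq_nonneg (a * d - b * c)]
  nlinarith

/-- **Uniqueness of the radial profile for `b⁴ ≤ 3a²c²`**: any two profile solutions on
`(0,R)` with positive `u`-component and negative `v`-component coincide on `(0,R)`. -/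
theorem stmt3 (a2 b2 c2 : ℝ) (ha : 0 < a2) (hb : 0 < b2) (hc : 0 < c2)
    (hle : b2 ^ 2 ≤ 3 * a2 * c2) (k : ℤ) (hk : k ≠ 0) (R : ℝ≥0∞) (hR : 0 < R)
    (u₁ v₁ u₂ v₂ : ℝ → ℝ)
    (hsol₁ : ProfileSolution a2 b2 c2 k R u₁ v₁)
    (hsol₂ : ProfileSolution a2 b2 c2 k R u₂ v₂)
    (hu₁ : ∀ r ∈ Iset R, 0 < u₁ r) (hv₁ : ∀ r ∈ Iset R, v₁ r < 0)
    (hu₂ : ∀ r ∈ Iset R, 0 < u₂ r) (hv₂ : ∀ r ∈ Iset R, v₂ r < 0) :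
    ∀ r ∈ Iset R, u₁ r = u₂ r ∧ v₁ r = v₂ r := by
  have hv₁' := hsol₁.v_le hb hc hle hR hv₁
  have hv₂' := hsol₂.v_le hb hc hle hR hv₂
  have hI := isOpen_Iset R
  have hdu₁ := fun r hr => hasDerivAt_of_contDiffOn_two hI hsol₁.smooth_u (r := r) hr
  have hdu₂ := fun r hr => hasDerivAt_of_contDiffOn_two hI hsol₂.smooth_u (r := r) hr
  have hdv₁ := fun r hr => hasDerivAt_of_contDiffOn_two hI hsol₁.smooth_v (r := r) hr
  have hdv₂ := fun r hr => hasDerivAt_of_contDiffOn_two hI hsol₂.smooth_v (r := r) hr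
  have hs : 0 < sPlus a2 b2 c2 := (div_pos hb hc).trans_le (div_le_sPlus hc hle)
  have hsu : sPlus a2 b2 c2 / Real.sqrt 2 ≠ 0 := by positivity
  have hsv : -(sPlus a2 b2 c2 / Real.sqrt 6) ≠ 0 := by
    rw [neg_ne_zero]; positivity
  let X : ℝ → ℝ := fun r => deriv u₁ r / u₁ r - deriv u₂ r / u₂ r
  let Y : ℝ → ℝ := fun r => deriv v₁ r / v₁ r - deriv v₂ r / v₂ r
  let Q : ℝ → ℝ := fun r =>
    X r ^ 2 * (u₁ r ^ 2 + u₂ r ^ 2) + Y r ^ 2 * (v₁ r ^ 2 + v₂ r ^ 2)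
  let T : ℝ → ℝ := fun r =>
    (((k : ℝ) ^ 2 / r ^ 2 * u₁ r + hfun a2 b2 c2 (u₁ r) (v₁ r)) / u₁ r
      - ((k : ℝ) ^ 2 / r ^ 2 * u₂ r + hfun a2 b2 c2 (u₂ r) (v₂ r)) / u₂ r)
        * (u₁ r ^ 2 - u₂ r ^ 2)
    + (gfun a2 b2 c2 (u₁ r) (v₁ r) / v₁ r - gfun a2 b2 c2 (u₂ r) (v₂ r) / v₂ r)
        * (v₁ r ^ 2 - v₂ r ^ 2)
  let B : ℝ → ℝ := fun r =>
    r * X r * (u₁ r ^ 2 - u₂ r ^ 2) + r * Y r * (v₁ r ^ 2 - v₂ r ^ 2)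
  let N : ℝ → ℝ := fun r => (u₁ r ^ 2 + v₁ r ^ 2) + (u₂ r ^ 2 + v₂ r ^ 2)
  have hT : ∀ r ∈ Iset R, 0 ≤ T r := fun r hr =>
    reaction_monotone hb hc (hu₁ r hr) (hu₂ r hr) (hv₁' r hr) (hv₂' r hr)
  have hQ : ∀ r, 0 ≤ Q r := fun r => by positivity
  have hB : ∀ r ∈ Iset R, HasDerivAt B (r * (T r + Q r)) r := by
    intro r hr
    have h1 := hasDerivAt_picone hr.1.ne' (hdu₁ r hr) (hdu₂ r hr) (hu₁ r hr).ne' (hu₂ r hr).ne'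
      (A₁ := (k : ℝ) ^ 2 / r ^ 2 * u₁ r + hfun a2 b2 c2 (u₁ r) (v₁ r))
      (A₂ := (k : ℝ) ^ 2 / r ^ 2 * u₂ r + hfun a2 b2 c2 (u₂ r) (v₂ r))
      (by rw [← hsol₁.ode_u r hr]; ring) (by rw [← hsol₂.ode_u r hr]; ring)
    have h2 := hasDerivAt_picone hr.1.ne' (hdv₁ r hr) (hdv₂ r hr) (hv₁ r hr).ne (hv₂ r hr).ne
      (hsol₁.ode_v r hr) (hsol₂.ode_v r hr)
    refine (h1.add h2).congr_deriv ?_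
    simp only [T, Q, X, Y]
    ring
  have hB' : ∀ r ∈ Iset R, 0 ≤ r * (T r + Q r) := fun r hr =>
    mul_nonneg hr.1.le (add_nonneg (hT r hr) (hQ r))
  have hmono : MonotoneOn B (Iset R) := monotoneOn_of_hasDerivAt_nonneg (convex_Iset R) hB hB'
  have hCS : ∀ r, B r ^ 2 ≤ r ^ 2 * (N r * Q r) := by
    intro r
    have h1 : (X r * (u₁ r ^ 2 - u₂ r ^ 2) + Y r * (v₁ r ^ 2 - v₂ r ^ 2)) ^ 2 ≤ N r * Q r := by
      have h2 : (X r * (u₁ r ^ 2 - u₂ r ^ 2)) ^ 2 ≤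
          (u₁ r ^ 2 + u₂ r ^ 2) * (X r ^ 2 * (u₁ r ^ 2 + u₂ r ^ 2)) := by
        have : 0 ≤ X r ^ 2 * (4 * u₁ r ^ 2 * u₂ r ^ 2) := by positivity
        linarith
      have h3 : (Y r * (v₁ r ^ 2 - v₂ r ^ 2)) ^ 2 ≤
          (v₁ r ^ 2 + v₂ r ^ 2) * (Y r ^ 2 * (v₁ r ^ 2 + v₂ r ^ 2)) := by
        have : 0 ≤ Y r ^ 2 * (4 * v₁ r ^ 2 * v₂ r ^ 2) := by positivity
        linarith
      have h4 := add_sq_le_mul_add_of_sq_le (by positivity) (by positivity) (by positivity)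
        (by positivity) h2 h3
      refine h4.trans_eq ?_
      simp only [N, Q]
      ring
    calc B r ^ 2 = r ^ 2 * (X r * (u₁ r ^ 2 - u₂ r ^ 2) + Y r * (v₁ r ^ 2 - v₂ r ^ 2)) ^ 2 := by
          simp only [B]; ring
      _ ≤ _ := by gcongr
  have hODI : ∀ C : ℝ, ∀ r ∈ Iset R, N r ≤ C → B r ^ 2 ≤ C * r * (r * (T r + Q r)) := by
    intro C r hr hN
    have hN0 : 0 ≤ N r := by positivity
    have h1 : N r * Q r ≤ C * (T r + Q r) :=
      mul_le_mul hN (by linarith [hT r hr]) (hQ r) (hN0.trans hN)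
    calc B r ^ 2 ≤ r ^ 2 * (N r * Q r) := hCS r
      _ ≤ r ^ 2 * (C * (T r + Q r)) := by gcongr
      _ = _ := by ring
  have hBnonneg : ∀ r ∈ Iset R, 0 ≤ B r := by
    obtain ⟨C₁, hC₁⟩ := hsol₁.eventually_bounded_zero hR hv₁
    obtain ⟨C₂, hC₂⟩ := hsol₂.eventually_bounded_zero hR hv₂
    obtain ⟨ρ, hρ, hsub⟩ := mem_nhdsGT_iff_exists_Ioo_subset.1
      ((hC₁.and hC₂).and (eventually_mem_Iset_zero hR))
    have hnear := nonneg_of_sq_le_mul_deriv (C := max (C₁ + C₂) 1) (by positivity)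
      (fun r hr => hB r (hsub hr).2) (fun r hr => hB' r (hsub hr).2)
      (fun r hr => hODI _ r (hsub hr).2
        ((add_le_add (hsub hr).1.1 (hsub hr).1.2).trans (le_max_left _ _)))
    intro r hr
    obtain ⟨x, hx, hxr⟩ := Filter.nonempty_of_mem
      (inter_mem (Ioo_mem_nhdsGT (Set.mem_Ioi.1 hρ)) (Ioo_mem_nhdsGT hr.1))
    exact (hnear x hx).trans (hmono (hsub hx).2 hr hxr.2.le)
  have hBnonpos : ∀ r ∈ Iset R, B r ≤ 0 := by
    intro r hr
    by_cases hRt : R = ⊤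
    · obtain ⟨C₁, hC₁⟩ := hsol₁.eventually_bounded_end
      obtain ⟨C₂, hC₂⟩ := hsol₂.eventually_bounded_end
      have hev := (hC₁.and hC₂).and (eventually_mem_Iset_end hr)
      simp only [endFilter, if_pos hRt] at hev
      obtain ⟨ρ, hρ⟩ := eventually_atTop.1 hev
      have hρr := (hρ ρ le_rfl).2.2
      have hfar := nonpos_of_sq_le_mul_deriv (C := max (C₁ + C₂) 1) (ρ := ρ) (by positivity)
        (hr.1.trans hρr).le
        (fun x hx => hB x (hρ x (le_of_lt hx)).2.1) (fun x hx => hB' x (hρ x (le_of_lt hx)).2.1)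
        (fun x hx => hODI _ x (hρ x (le_of_lt hx)).2.1
          ((add_le_add (hρ x (le_of_lt hx)).1.1 (hρ x (le_of_lt hx)).1.2).trans (le_max_left _ _)))
      exact (hmono hr (hρ (ρ + 1) (by linarith)).2.1 (by linarith)).trans
        (hfar (ρ + 1) (by simp))
    · have hd₁ := hsol₁.eventually_deriv_bounded hR hRt
      have hd₂ := hsol₂.eventually_deriv_bounded hR hRt
      have hlim : Tendsto B (endFilter R) (𝓝 (0 + 0)) :=
        (tendsto_picone_boundary hsu hsol₁.bcR_u hsol₂.bcR_u hd₁.1 hd₂.1).add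
          (tendsto_picone_boundary hsv hsol₁.bcR_v hsol₂.bcR_v hd₁.2 hd₂.2)
      rw [add_zero] at hlim
      exact ge_of_tendsto hlim
        ((eventually_mem_Iset_end hr).mono fun x hx => hmono hr hx.1 hx.2.le)
  have hQ0 : ∀ r ∈ Iset R, Q r = 0 := by
    intro r hr
    have h1 : HasDerivAt B 0 r := (hasDerivAt_const r (0 : ℝ)).congr_of_eventuallyEq
      (Filter.mem_of_superset (hI.mem_nhds hr) fun x hx =>
        le_antisymm (hBnonpos x hx) (hBnonneg x hx))
    have h2 := (mul_eq_zero.1 ((hB r hr).unique h1)).resolve_left hr.1.ne'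
    linarith [hT r hr, hQ r]
  have hX : ∀ r ∈ Iset R, X r = 0 ∧ Y r = 0 := by
    intro r hr
    have hu : 0 < u₁ r ^ 2 + u₂ r ^ 2 := by have := hu₁ r hr; positivity
    have hv : 0 < v₁ r ^ 2 + v₂ r ^ 2 := by have := sq_pos_of_neg (hv₁ r hr); positivity
    obtain ⟨h1, h2⟩ := (add_eq_zero_iff_of_nonneg (by positivity) (by positivity)).1 (hQ0 r hr)
    exact ⟨by simpa [hu.ne'] using h1, by simpa [hv.ne'] using h2⟩
  intro r hr
  exact ⟨eqOn_of_logDeriv_eq hsu hsol₁.bcR_u hsol₂.bcR_u (fun x hx => (hdu₁ x hx).1)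
      (fun x hx => (hdu₂ x hx).1) (fun x hx => (hu₁ x hx).ne') (fun x hx => (hu₂ x hx).ne')
      (fun x hx => sub_eq_zero.1 (hX x hx).1) r hr,
    eqOn_of_logDeriv_eq hsv hsol₁.bcR_v hsol₂.bcR_v (fun x hx => (hdv₁ x hx).1)
      (fun x hx => (hdv₂ x hx).1) (fun x hx => (hv₁ x hx).ne) (fun x hx => (hv₂ x hx).ne)
      (fun x hx => sub_eq_zero.1 (hX x hx).2) r hr⟩

end
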